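/- Let Y ⊆ ℝ^p be nonempty and closed, X ⊆ ℝ^d, and let S : X ⇉ Y be a continuous set-valued map with nonempty convex compact values. If the Neutral belief ι : X → 𝒫(Y) over S is weak continuous, then the centroid map x ↦ 𝔠(S(x)) = (1/λ_{d_x}(S(x))) ∫_{S(x)} y dλ_{d_x}(y), where d_x is the affine dimension of S(x), is continuous on X. -/

import Mathlib

open MeasureTheory Filter Topology Set Pointwise
open scoped ENNReal

/-- The affine dimension of a set: the dimension of its affine hull. -/
noncomputable def adim {p : ℕ} (A : Set (EuclideanSpace ℝ (Fin p))) : ℕ :=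
  Module.finrank ℝ (affineSpan ℝ A).direction

/-- The centroid of a set `K`, computed with respect to the `adim K`-dimensional
Hausdorff measure: `𝔠(K) = (1/λ_k(K)) ∫_K y dλ_k(y)` with `k = adim K`. -/
noncomputable def centroid {p : ℕ} (K : Set (EuclideanSpace ℝ (Fin p))) :
    EuclideanSpace ℝ (Fin p) :=
  (μH[(adim K : ℝ)] K).toReal⁻¹ •
    ∫ y in K, y ∂(μH[(adim K : ℝ)] : Measure (EuclideanSpace ℝ (Fin p)))

/-- The Neutral belief over `S`: the normalized `adim (S x)`-dimensional Hausdorff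
(Lebesgue) measure on `S x`. -/
noncomputable def neutralBelief {d p : ℕ}
    (S : EuclideanSpace ℝ (Fin d) → Set (EuclideanSpace ℝ (Fin p)))
    (x : EuclideanSpace ℝ (Fin d)) : Measure (EuclideanSpace ℝ (Fin p)) :=
  (μH[(adim (S x) : ℝ)] (S x))⁻¹ •
    (μH[(adim (S x) : ℝ)] : Measure (EuclideanSpace ℝ (Fin p))).restrict (S x)

/-- Continuity of a set-valued map at a point (Hausdorff-distance style). -/
def SVContinuousAt {d p : ℕ} (X : Set (EuclideanSpace ℝ (Fin d)))
    (S : EuclideanSpace ℝ (Fin d) → Set (EuclideanSpace ℝ (Fin p)))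
    (xb : EuclideanSpace ℝ (Fin d)) : Prop :=
  ∀ ε > (0 : ℝ), ∃ δ > (0 : ℝ), ∀ x ∈ X, ‖x - xb‖ < δ →
    S x ⊆ S xb + Metric.closedBall 0 ε ∧ S xb ⊆ S x + Metric.closedBall 0 ε

section NeutralBelief

variable {d p : ℕ} {S : EuclideanSpace ℝ (Fin d) → Set (EuclideanSpace ℝ (Fin p))}
  {x : EuclideanSpace ℝ (Fin d)}

theorem centroid_eq_integral_neutralBelief
    (S : EuclideanSpace ℝ (Fin d) → Set (EuclideanSpace ℝ (Fin p)))
    (x : EuclideanSpace ℝ (Fin d)) :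
    centroid (S x) = ∫ y, y ∂(neutralBelief S x) := by
  rw [centroid, neutralBelief, integral_smul_measure, ENNReal.toReal_inv]

theorem neutralBelief_univ_le_one : neutralBelief S x univ ≤ 1 := by
  simp [neutralBelief, ENNReal.inv_mul_le_one]

theorem ae_mem_neutralBelief (hS : IsCompact (S x)) :
    ∀ᵐ y ∂(neutralBelief S x), y ∈ S x :=
  Measure.ae_smul_measure (ae_restrict_mem hS.measurableSet) _

theorem integrable_id_neutralBelief (hS : IsCompact (S x)) :
    Integrable (fun y => y) (neutralBelief S x) := by
  have : IsFiniteMeasure (neutralBelief S x) :=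
    ⟨neutralBelief_univ_le_one.trans_lt ENNReal.one_lt_top⟩
  obtain ⟨C, hC⟩ := hS.isBounded.exists_norm_le
  exact Integrable.of_bound aestronglyMeasurable_id C
    ((ae_mem_neutralBelief hS).mono fun y hy => hC y hy)

theorem centroid_apply_eq_integral (hS : IsCompact (S x)) (i : Fin p) :
    centroid (S x) i = ∫ y, y i ∂(neutralBelief S x) := by
  rw [centroid_eq_integral_neutralBelief]
  exact ((EuclideanSpace.proj (𝕜 := ℝ) i).integral_comp_comm
    (integrable_id_neutralBelief hS)).symm

/-- On a set bounded by `R`, coordinates may be truncated at `±R` without changing the centroid. -/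
theorem integral_truncation_eq_centroid_apply (hS : IsCompact (S x)) {R : ℝ}
    (hR : ∀ y ∈ S x, ‖y‖ ≤ R) (i : Fin p) :
    ∫ y, max (-R) (min (y i) R) ∂(neutralBelief S x) = centroid (S x) i := by
  rw [centroid_apply_eq_integral hS]
  refine integral_congr_ae ((ae_mem_neutralBelief hS).mono fun y hy => ?_)
  have h := abs_le.1 ((PiLp.norm_apply_le y i).trans (hR y hy))
  simp only [min_eq_left h.2, max_eq_right h.1]

end NeutralBelief

/-- A set-valued map continuous at `xb` with bounded value there is uniformly bounded near `xb`. -/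
theorem SVContinuousAt.exists_norm_le {d p : ℕ} {X : Set (EuclideanSpace ℝ (Fin d))}
    {S : EuclideanSpace ℝ (Fin d) → Set (EuclideanSpace ℝ (Fin p))}
    {xb : EuclideanSpace ℝ (Fin d)} (h : SVContinuousAt X S xb)
    (hb : Bornology.IsBounded (S xb)) :
    ∃ R : ℝ, 0 ≤ R ∧ ∃ δ > 0, ∀ x ∈ X, ‖x - xb‖ < δ → ∀ y ∈ S x, ‖y‖ ≤ R := by
  obtain ⟨δ, hδ, hS⟩ := h 1 one_pos
  obtain ⟨R, hR, hle⟩ := (hb.add Metric.isBounded_closedBall).exists_pos_norm_le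
  exact ⟨R, hR.le, δ, hδ, fun x hx hxd y hy => hle y ((hS x hx hxd).1 hy)⟩

/-- If `S` is a continuous set-valued map with nonempty convex compact
values and the Neutral belief over `S` is weak continuous, then the centroid map
`x ↦ 𝔠(S(x))` is continuous on `X`. -/
theorem stmt_2 {d p : ℕ}
    (X : Set (EuclideanSpace ℝ (Fin d))) (Y : Set (EuclideanSpace ℝ (Fin p)))
    (hYne : Y.Nonempty) (hYcl : IsClosed Y)
    (S : EuclideanSpace ℝ (Fin d) → Set (EuclideanSpace ℝ (Fin p)))
    (hSY : ∀ x ∈ X, S x ⊆ Y)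
    (hSne : ∀ x ∈ X, (S x).Nonempty)
    (hSconv : ∀ x ∈ X, Convex ℝ (S x))
    (hScomp : ∀ x ∈ X, IsCompact (S x))
    (hScont : ∀ xb ∈ X, SVContinuousAt X S xb)
    -- weak continuity of the Neutral belief over `S`
    (hιw : ∀ (xseq : ℕ → EuclideanSpace ℝ (Fin d)) (xb : EuclideanSpace ℝ (Fin d)),
      (∀ n, xseq n ∈ X) → xb ∈ X → Tendsto xseq atTop (𝓝 xb) →
      ∀ f : EuclideanSpace ℝ (Fin p) → ℝ, Continuous f → (∃ C, ∀ y, |f y| ≤ C) →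
        Tendsto (fun n => ∫ y, f y ∂(neutralBelief S (xseq n))) atTop
          (𝓝 (∫ y, f y ∂(neutralBelief S xb)))) :
    ContinuousOn (fun x => centroid (S x)) X := by
  rw [continuousOn_iff_continuous_domRestrict]
  refine continuous_iff_seqContinuous.2 fun u a hu => ?_
  obtain ⟨R, hR0, δ, hδ, hR⟩ := (hScont a a.2).exists_norm_le (hScomp a a.2).isBounded
  have hu' : Tendsto (fun n => (u n : EuclideanSpace ℝ (Fin d))) atTop (𝓝 a) :=
    (continuous_subtype_val.tendsto a).comp hu
  have hcoord (i : Fin p) : Tendsto (fun n => centroid (S (u n)) i) atTop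
      (𝓝 (centroid (S a) i)) := by
    have hlim := hιw _ _ (fun n => (u n).2) a.2 hu' (fun y => max (-R) (min (y i) R))
      (by fun_prop)
      ⟨R, fun y => abs_le.2 ⟨le_max_left _ _, max_le (by linarith) (min_le_right _ _)⟩⟩
    rw [integral_truncation_eq_centroid_apply (hScomp a a.2) (hR a a.2 (by simpa using hδ))]
      at hlim
    refine hlim.congr' ?_
    filter_upwards [hu'.eventually (Metric.ball_mem_nhds _ hδ)] with n hn
    exact integral_truncation_eq_centroid_apply (hScomp _ (u n).2)
      (hR _ (u n).2 (mem_ball_iff_norm.1 hn)) i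
  exact ((PiLp.continuous_toLp 2 fun _ : Fin p => ℝ).tendsto _).comp (tendsto_pi_nhds.2 hcoord)
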